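/- arXiv:2404.03104 — 2 statements merged into one kernel-verified Lean document; each statement's English description precedes it below -/
import Mathlib

section
/- Let G be a finitely presented group which is CEP-equipped, i.e., for every finite n ≥ 2, G contains a subgroup isomorphic to the free group of rank n that satisfies CEP as a subgroup of G. Then G is quotient-saturated: for every finite set V, every partial order ≤ on V, and every coloring c : V → {0,1}, there exists an assignment of normal subgroups N_v ⊴ G (v ∈ V) such that v ↦ N_v is injective, u ≤ v if and only if N_u ≤ N_v, and G/N_v is finitely presented if and only if c(v) = 0. -/
/-- A group is *finitely presented* if it is isomorphic to the quotient of a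
finitely generated free group by the normal closure of a finite set of relators. -/
def FinitelyPresented (G : Type*) [Group G] : Prop :=
  ∃ (n : ℕ) (R : Set (FreeGroup (Fin n))), R.Finite ∧
    Nonempty ((FreeGroup (Fin n) ⧸ Subgroup.normalClosure R) ≃* G)

/-- A subgroup `H ≤ G` satisfies the *Congruence Extension Property* (CEP) if for
every subset `R ⊆ H`, the normal closure of `R` in `H` equals `H ∩ ⟪R⟫_G`
(expressed as the pullback of the normal closure of `R` in `G` along `H ↪ G`). -/
def IsCEP {G : Type*} [Group G] (H : Subgroup G) : Prop :=
  ∀ R : Set H, Subgroup.normalClosure R =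
    (Subgroup.normalClosure (Subtype.val '' R)).comap H.subtype

/-- A group `G` is *quotient-saturated* if every finite partial order equipped with a
`{0,1}`-coloring is realizable in `G` by normal subgroups. -/
def QuotientSaturated (G : Type*) [Group G] : Prop :=
  ∀ (V : Type) [Fintype V] [PartialOrder V] (c : V → Fin 2),
    ∃ N : V → Subgroup G,
      Function.Injective N ∧
      (∀ u v : V, u ≤ v ↔ N u ≤ N v) ∧
      (∀ v : V, ∃ h : (N v).Normal,
        ((letI := h; FinitelyPresented (G ⧸ N v)) ↔ c v = 0))

open Subgroup in
/-- A finite subset of a normal closure lies in the normal closure of finitely many generators. -/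
theorem Subgroup.exists_finite_subset_normalClosure {G : Type*} [Group G] {R S : Set G}
    (hS : S.Finite) (hSR : S ⊆ normalClosure R) :
    ∃ T : Set G, T.Finite ∧ T ⊆ R ∧ S ⊆ normalClosure T := by
  have key : ∀ x ∈ normalClosure R, ∃ T : Set G, T.Finite ∧ T ⊆ R ∧ x ∈ normalClosure T := by
    intro x hx
    refine closure_induction (p := fun x _ => ∃ T : Set G, T.Finite ∧ T ⊆ R ∧ x ∈ normalClosure T)
      ?_ ?_ ?_ ?_ hx
    · intro y hy
      obtain ⟨r, hr, hry⟩ := Group.mem_conjugatesOfSet_iff.mp hy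
      refine ⟨{r}, Set.finite_singleton r, by simpa using hr, ?_⟩
      exact conjugatesOfSet_subset_normalClosure
        (Group.mem_conjugatesOfSet_iff.mpr ⟨r, Set.mem_singleton r, hry⟩)
    · exact ⟨∅, Set.finite_empty, Set.empty_subset R, one_mem _⟩
    · rintro y z - - ⟨T, hT, hTR, hy⟩ ⟨U, hU, hUR, hz⟩
      exact ⟨T ∪ U, hT.union hU, Set.union_subset hTR hUR,
        mul_mem (normalClosure_mono Set.subset_union_left hy)
          (normalClosure_mono Set.subset_union_right hz)⟩
    · rintro y - ⟨T, hT, hTR, hy⟩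
      exact ⟨T, hT, hTR, inv_mem hy⟩
  choose! T hT hTR hxT using key
  refine ⟨⋃ x ∈ S, T x, hS.biUnion fun x hx => hT x (hSR hx),
    Set.iUnion₂_subset fun x hx => hTR x (hSR hx), fun x hx => ?_⟩
  exact normalClosure_mono (Set.subset_biUnion_of_mem (u := T) hx) (hxT x (hSR hx))

open Subgroup in
/-- A finitely normally generated normal closure is generated by finitely many of the given
normal generators. -/
theorem Subgroup.IsFinitelyNormallyGenerated.exists_finite_subset {G : Type*} [Group G]
    {R : Set G} (h : (normalClosure R).IsFinitelyNormallyGenerated) :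
    ∃ T : Set G, T.Finite ∧ T ⊆ R ∧ normalClosure T = normalClosure R := by
  obtain ⟨S, hS, hSR⟩ := h
  obtain ⟨T, hT, hTR, hST⟩ :=
    exists_finite_subset_normalClosure hS (hSR ▸ subset_normalClosure)
  exact ⟨T, hT, hTR, le_antisymm (normalClosure_mono hTR) (hSR ▸ normalClosure_le_normal hST)⟩

/-- The finite presentability predicate agrees with Mathlib's. -/
theorem finitelyPresented_iff_isFinitelyPresented {G : Type*} [Group G] :
    FinitelyPresented G ↔ Group.IsFinitelyPresented G := by
  constructor
  · rintro ⟨n, R, hR, ⟨e⟩⟩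
    have : Group.IsFinitelyPresented (FreeGroup (Fin n) ⧸ Subgroup.normalClosure R) :=
      Group.IsFinitelyPresented.quotient _ ⟨R, hR, rfl⟩
    exact Group.IsFinitelyPresented.equiv e
  · intro h
    obtain ⟨n, R, hR, ⟨e⟩⟩ := Group.IsFinitelyPresented.exists_mulEquiv_presentedGroup (G := G)
    exact ⟨n, R, hR, ⟨e.symm⟩⟩

theorem Group.IsFinitelyPresented.fg (G : Type*) [Group G] [h : Group.IsFinitelyPresented G] :
    Group.FG G := by
  obtain ⟨n, φ, hφ, -⟩ := h.out
  exact Group.fg_of_surjective hφ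

open Subgroup in
/-- The kernel of a surjection from a finitely generated group onto a finitely presented group
is finitely normally generated. -/
theorem Group.IsFinitelyPresented.isFinitelyNormallyGenerated_ker {G Q : Type*} [Group G]
    [Group Q] [hG : Group.FG G] [hQ : Group.IsFinitelyPresented Q] (π : G →* Q)
    (hπ : Function.Surjective π) : π.ker.IsFinitelyNormallyGenerated := by
  obtain ⟨n, φ, hφ, R, hR, hRφ⟩ := hQ.out
  obtain ⟨A, hA, hAfin⟩ := Group.fg_iff.mp hG
  choose lift hlift using hπ
  choose h hh using fun a : G => hφ (π a)
  let θ : FreeGroup (Fin n) →* G := FreeGroup.lift fun i => lift (φ (FreeGroup.of i))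
  have hθ : ∀ x, π (θ x) = φ x := by
    have : π.comp θ = φ := by
      ext i
      simp [θ, hlift]
    exact fun x => DFunLike.congr_fun this x
  refine ⟨θ '' R ∪ (fun a => a⁻¹ * θ (h a)) '' A, (hR.image _).union (hAfin.image _), ?_⟩
  set K := normalClosure (θ '' R ∪ (fun a => a⁻¹ * θ (h a)) '' A)
  have hKπ : K ≤ π.ker := by
    refine normalClosure_le_normal ?_
    rintro _ (⟨r, hr, rfl⟩ | ⟨a, -, rfl⟩)
    · have : r ∈ φ.ker := hRφ ▸ subset_normalClosure hr
      simpa [hθ] using this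
    · simp [hθ, hh]
  refine le_antisymm hKπ ?_
  have hker : φ.ker ≤ K.comap θ := by
    rw [← hRφ]
    exact normalClosure_le_normal fun r hr =>
      subset_normalClosure (Or.inl (Set.mem_image_of_mem θ hr))
  have hsurj : ((QuotientGroup.mk' K).comp θ).range = ⊤ := by
    rw [eq_top_iff, ← map_top_of_surjective _ (QuotientGroup.mk'_surjective K), ← hA,
      MonoidHom.map_closure, closure_le]
    rintro _ ⟨a, ha, rfl⟩
    refine ⟨h a, Eq.symm ?_⟩
    exact QuotientGroup.eq.mpr (subset_normalClosure (Or.inr ⟨a, ha, rfl⟩))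
  intro g hg
  obtain ⟨x, hx⟩ := MonoidHom.range_eq_top.mp hsurj (QuotientGroup.mk' K g)
  have hxg : (θ x)⁻¹ * g ∈ K := QuotientGroup.eq.mp hx
  have hπx : π ((θ x)⁻¹ * g) = 1 := hKπ hxg
  have hφx : x ∈ φ.ker := by
    rw [MonoidHom.mem_ker] at hg ⊢
    simpa [hg, hθ] using hπx
  simpa using mul_mem (mem_comap.mp (hker hφx)) hxg

namespace QuotientSaturated

open scoped commutatorElement

variable {V : Type*}

/-- The distinguished stable generator of the free group on `Option (Option V)`. -/
def stableGen : FreeGroup (Option (Option V)) := FreeGroup.of none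

/-- The generator of the free group on `Option (Option V)` attached to `v`. -/
def vertexGen (v : V) : FreeGroup (Option (Option V)) := FreeGroup.of (some (some v))

/-- The commutator of the generator of `v` with its conjugate by the `(i + 1)`-st power of the
stable generator. -/
def vertexComm (v : V) (i : ℕ) : FreeGroup (Option (Option V)) :=
  ⁅vertexGen v, stableGen ^ (i + 1) * vertexGen v * (stableGen ^ (i + 1))⁻¹⁆

/-- The relators realizing `v`: the generators of all smaller elements, together with the
generator of `v` if `c v = 0` and the commutators of `v` otherwise. -/
def relators [Preorder V] (c : V → Fin 2) (v : V) : Set (FreeGroup (Option (Option V))) :=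
  {x | (∃ u < v, x = vertexGen u) ∨ (c v = 0 ∧ x = vertexGen v) ∨
    (c v ≠ 0 ∧ ∃ i, x = vertexComm v i)}

open Classical in
/-- The action on `ℤ` in which the stable generator shifts, the generator of `v` swaps `0` and
`n + 1`, and all other generators are trivial. -/
noncomputable def permRep (v : V) (n : ℕ) :
    FreeGroup (Option (Option V)) →* Equiv.Perm ℤ :=
  FreeGroup.lift fun a => if a = none then Equiv.addRight 1
    else if a = some (some v) then Equiv.swap 0 (n + 1) else 1

theorem permRep_stableGen (v : V) (n : ℕ) : permRep v n stableGen = Equiv.addRight 1 := by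
  simp [permRep, stableGen]

theorem permRep_vertexGen_self (v : V) (n : ℕ) :
    permRep v n (vertexGen v) = Equiv.swap (0 : ℤ) (n + 1) := by
  simp [permRep, vertexGen]

theorem permRep_vertexGen_of_ne {u v : V} (h : u ≠ v) (n : ℕ) :
    permRep v n (vertexGen u) = 1 := by
  simp [permRep, vertexGen, h]

theorem permRep_vertexComm_of_ne {u v : V} (h : u ≠ v) (n i : ℕ) :
    permRep v n (vertexComm u i) = 1 := by
  simp [vertexComm, permRep_vertexGen_of_ne h, map_commutatorElement]

theorem shift_conj_swap (k : ℕ) (a b : ℤ) :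
    (Equiv.addRight 1 : Equiv.Perm ℤ) ^ k * Equiv.swap a b *
      ((Equiv.addRight 1 : Equiv.Perm ℤ) ^ k)⁻¹ = Equiv.swap (a + k) (b + k) := by
  rw [← Equiv.swap_apply_apply]
  simp

theorem permRep_vertexComm_self (v : V) (n i : ℕ) :
    permRep v n (vertexComm v i) =
      ⁅Equiv.swap (0 : ℤ) (n + 1), Equiv.swap ((i : ℤ) + 1) (n + i + 2)⁆ := by
  have h := shift_conj_swap (i + 1) 0 (n + 1)
  rw [vertexComm, map_commutatorElement, map_mul, map_mul, map_inv, map_pow, permRep_stableGen,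
    permRep_vertexGen_self, h]
  congr 2 <;> push_cast <;> ring

theorem permRep_vertexComm_self_eq_one {v : V} {n i : ℕ} (h : i ≠ n) :
    permRep v n (vertexComm v i) = 1 := by
  rw [permRep_vertexComm_self, commutatorElement_eq_one_iff_commute]
  apply Equiv.Perm.Disjoint.commute
  intro x
  by_cases h0 : x = 0
  · right; apply Equiv.swap_apply_of_ne_of_ne <;> omega
  by_cases h1 : x = n + 1
  · right; apply Equiv.swap_apply_of_ne_of_ne <;> omega
  · left; exact Equiv.swap_apply_of_ne_of_ne h0 h1

theorem permRep_vertexComm_self_ne_one (v : V) (n : ℕ) :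
    permRep v n (vertexComm v n) ≠ 1 := by
  rw [permRep_vertexComm_self, Ne, commutatorElement_eq_one_iff_mul_comm]
  intro h
  have h0 := DFunLike.congr_fun h (0 : ℤ)
  rw [Equiv.Perm.mul_apply, Equiv.Perm.mul_apply, Equiv.swap_apply_left,
    Equiv.swap_apply_left,
    Equiv.swap_apply_of_ne_of_ne (a := (n : ℤ) + 1) (b := n + n + 2) (x := 0) (by omega) (by omega),
    Equiv.swap_apply_left] at h0
  omega

theorem vertexComm_injective (v : V) : Function.Injective (vertexComm v) := by
  intro i j hij
  by_contra h
  exact permRep_vertexComm_self_ne_one v j (hij ▸ permRep_vertexComm_self_eq_one h)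

open Subgroup

theorem vertexComm_mem {v : V} {N : Subgroup (FreeGroup (Option (Option V)))} [hN : N.Normal]
    (h : vertexGen v ∈ N) (i : ℕ) : vertexComm v i ∈ N := by
  have h' := hN.conj_mem _ h (stableGen ^ (i + 1))
  exact mul_mem (mul_mem (mul_mem h h') (inv_mem h)) (inv_mem h')

variable [PartialOrder V] (c : V → Fin 2)

theorem normalClosure_relators_le_iff (u v : V) :
    normalClosure (relators c u) ≤ normalClosure (relators c v) ↔ u ≤ v := by
  constructor
  · intro h
    by_contra huv
    have hne : v ≠ u := fun e => huv e.ge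
    have hker : normalClosure (relators c u) ≤ (permRep u 0).ker := by
      refine h.trans (normalClosure_le_normal ?_)
      rintro _ (⟨w, hw, rfl⟩ | ⟨-, rfl⟩ | ⟨-, i, rfl⟩)
      · exact permRep_vertexGen_of_ne (by rintro rfl; exact huv hw.le) 0
      · exact permRep_vertexGen_of_ne hne 0
      · exact permRep_vertexComm_of_ne hne 0 i
    by_cases hu : c u = 0
    · have := hker (subset_normalClosure (Or.inr (Or.inl ⟨hu, rfl⟩)))
      rw [MonoidHom.mem_ker, permRep_vertexGen_self, Equiv.swap_eq_one_iff] at this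
      omega
    · exact permRep_vertexComm_self_ne_one u 0
        (hker (subset_normalClosure (Or.inr (Or.inr ⟨hu, 0, rfl⟩))))
  · intro huv
    rcases huv.eq_or_lt with rfl | hlt
    · exact le_rfl
    have hmem : vertexGen u ∈ normalClosure (relators c v) :=
      subset_normalClosure (Or.inl ⟨u, hlt, rfl⟩)
    refine normalClosure_le_normal ?_
    rintro _ (⟨w, hw, rfl⟩ | ⟨-, rfl⟩ | ⟨-, i, rfl⟩)
    · exact subset_normalClosure (Or.inl ⟨w, hw.trans hlt, rfl⟩)
    · exact hmem
    · exact vertexComm_mem hmem i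

theorem isFinitelyNormallyGenerated_relators_iff [Finite V] (v : V) :
    (normalClosure (relators c v)).IsFinitelyNormallyGenerated ↔ c v = 0 := by
  constructor
  · intro h
    by_contra hv
    obtain ⟨T, hT, hTR, hTeq⟩ := h.exists_finite_subset
    have hmem : ∀ n, vertexComm v n ∈ T := by
      intro n
      by_contra hn
      have hker : normalClosure T ≤ (permRep v n).ker := by
        refine normalClosure_le_normal fun x hx => ?_
        rcases hTR hx with ⟨w, hw, rfl⟩ | ⟨h0, rfl⟩ | ⟨-, i, rfl⟩
        · exact permRep_vertexGen_of_ne hw.ne n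
        · exact absurd h0 hv
        · exact permRep_vertexComm_self_eq_one fun e => hn (e ▸ hx)
      rw [hTeq] at hker
      exact permRep_vertexComm_self_ne_one v n
        (hker (subset_normalClosure (Or.inr (Or.inr ⟨hv, n, rfl⟩))))
    exact Set.infinite_of_injective_forall_mem (vertexComm_injective v) hmem hT
  · intro hv
    refine ⟨relators c v, (Set.finite_range (vertexGen (V := V))).subset ?_, rfl⟩
    rintro _ (⟨w, -, rfl⟩ | ⟨-, rfl⟩ | ⟨h, -⟩)
    · exact ⟨w, rfl⟩
    · exact ⟨v, rfl⟩
    · exact absurd hv h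

end QuotientSaturated

open Subgroup in
/-- The congruence extension property transported along an isomorphism onto the subgroup. -/
theorem IsCEP.normalClosure_eq_comap {F G : Type*} [Group F] [Group G] {H : Subgroup G}
    (hH : IsCEP H) (e : H ≃* F) (R : Set F) :
    normalClosure R = (normalClosure (H.subtype.comp e.symm.toMonoidHom '' R)).comap
      (H.subtype.comp e.symm.toMonoidHom) := by
  have h := congrArg (comap e.symm.toMonoidHom) (hH (e.symm '' R))
  rw [comap_comap, Set.image_image] at h
  refine Eq.trans ?_ h
  have hm := map_normalClosure R e.symm.toMonoidHom e.symm.surjective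
  change _ = comap _ (normalClosure (e.symm.toMonoidHom '' R))
  rw [← hm, comap_map_eq_self_of_injective e.symm.injective]

open Subgroup in
/-- For a homomorphism satisfying the congruence extension property, finite normal generation
of a normal closure can be tested after applying the homomorphism. -/
theorem isFinitelyNormallyGenerated_normalClosure_image_iff {F G : Type*} [Group F] [Group G]
    {f : F →* G} (hf : ∀ R : Set F, normalClosure R = (normalClosure (f '' R)).comap f)
    (R : Set F) :
    (normalClosure (f '' R)).IsFinitelyNormallyGenerated ↔
      (normalClosure R).IsFinitelyNormallyGenerated := by
  constructor
  · intro h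
    obtain ⟨T, hT, hTR, hTeq⟩ := h.exists_finite_subset
    obtain ⟨S, -, hS, hST⟩ := Set.exists_subset_image_finite_and.mp ⟨T, hTR, hT, rfl⟩
    exact ⟨S, hS, by rw [hf S, ← hST, hTeq, ← hf R]⟩
  · intro h
    obtain ⟨T, hT, hTR, hTeq⟩ := h.exists_finite_subset
    refine ⟨f '' T, hT.image f, le_antisymm (normalClosure_mono (Set.image_mono hTR)) ?_⟩
    refine normalClosure_le_normal (Set.image_subset_iff.mpr fun r hr => ?_)
    have : r ∈ (normalClosure (f '' T)).comap f := by
      rw [← hf, hTeq]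
      exact subset_normalClosure hr
    exact this

open Subgroup in
/-- For a homomorphism satisfying the congruence extension property, inclusion of normal closures
can be tested after applying the homomorphism. -/
theorem normalClosure_image_le_iff {F G : Type*} [Group F] [Group G]
    {f : F →* G} (hf : ∀ R : Set F, normalClosure R = (normalClosure (f '' R)).comap f)
    (R S : Set F) :
    normalClosure (f '' R) ≤ normalClosure (f '' S) ↔ normalClosure R ≤ normalClosure S := by
  constructor
  · intro h
    rw [hf R, hf S]
    exact comap_mono h
  · intro h
    refine normalClosure_le_normal (Set.image_subset_iff.mpr fun r hr => ?_)
    have := h (subset_normalClosure hr)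
    rw [hf S] at this
    exact this

/-- Main theorem: a finitely presented CEP-equipped group is quotient-saturated. -/
theorem stmt_10 {G : Type*} [Group G] (hfp : FinitelyPresented G)
    (hcep : ∀ n : ℕ, 2 ≤ n →
      ∃ H : Subgroup G, IsCEP H ∧ Nonempty (H ≃* FreeGroup (Fin n))) :
    QuotientSaturated G := by
  intro V _ _ c
  obtain ⟨H, hH, ⟨e⟩⟩ := hcep (Fintype.card (Option (Option V))) (by simp)
  have hf := hH.normalClosure_eq_comap
    (e.trans (FreeGroup.freeGroupCongr (Fintype.equivFin (Option (Option V))).symm))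
  set f := H.subtype.comp (MulEquiv.toMonoidHom (MulEquiv.symm
    (e.trans (FreeGroup.freeGroupCongr (Fintype.equivFin (Option (Option V))).symm))))
  have hle : ∀ u v : V, u ≤ v ↔
      Subgroup.normalClosure (f '' QuotientSaturated.relators c u) ≤
        Subgroup.normalClosure (f '' QuotientSaturated.relators c v) := fun u v => by
    rw [normalClosure_image_le_iff hf, QuotientSaturated.normalClosure_relators_le_iff]
  have hG := finitelyPresented_iff_isFinitelyPresented.mp hfp
  have hfg := Group.IsFinitelyPresented.fg G
  refine ⟨fun v => Subgroup.normalClosure (f '' QuotientSaturated.relators c v),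
    fun u v huv => le_antisymm ((hle u v).mpr huv.le) ((hle v u).mpr huv.ge), hle,
    fun v => ⟨inferInstance, ?_⟩⟩
  rw [finitelyPresented_iff_isFinitelyPresented,
    ← QuotientSaturated.isFinitelyNormallyGenerated_relators_iff c v,
    ← isFinitelyNormallyGenerated_normalClosure_image_iff hf]
  refine ⟨fun h => ?_, fun h => Group.IsFinitelyPresented.quotient _ h⟩
  have hk := Group.IsFinitelyPresented.isFinitelyNormallyGenerated_ker
    (QuotientGroup.mk' (Subgroup.normalClosure (f '' QuotientSaturated.relators c v)))
    (QuotientGroup.mk'_surjective _)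
  rwa [QuotientGroup.ker_mk'] at hk
end

section
/- For every finite n ≥ 2, the free group F_n of rank n is quotient-saturated: for every finite set V, every partial order ≤ on V, and every coloring c : V → {0,1}, there exists an assignment of normal subgroups N_v ⊴ F_n (v ∈ V) such that v ↦ N_v is injective, u ≤ v if and only if N_u ≤ N_v, and F_n/N_v is finitely presented if and only if c(v) = 0. -/
open Subgroup
open scoped commutatorElement

theorem isFinitelyNormallyGenerated_of_quotient_mulEquiv {α β : Type*} [Finite α]
    {N : Subgroup (FreeGroup α)} [N.Normal] {R : Set (FreeGroup β)} (hR : R.Finite)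
    (e : (FreeGroup β ⧸ normalClosure R) ≃* (FreeGroup α ⧸ N)) :
    N.IsFinitelyNormallyGenerated := by
  choose f hf using fun i : β => QuotientGroup.mk'_surjective N
    (e (QuotientGroup.mk' (normalClosure R) (FreeGroup.of i)))
  choose g hg using fun i : α => QuotientGroup.mk'_surjective (normalClosure R)
    (e.symm (QuotientGroup.mk' N (FreeGroup.of i)))
  have hF : ∀ w, QuotientGroup.mk' N (FreeGroup.lift f w) =
      e (QuotientGroup.mk' (normalClosure R) w) := by
    intro w
    have : (QuotientGroup.mk' N).comp (FreeGroup.lift f) =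
        e.toMonoidHom.comp (QuotientGroup.mk' (normalClosure R)) := by
      ext i; simpa using hf i
    exact DFunLike.congr_fun this w
  have hG : ∀ w, QuotientGroup.mk' (normalClosure R) (FreeGroup.lift g w) =
      e.symm (QuotientGroup.mk' N w) := by
    intro w
    have : (QuotientGroup.mk' (normalClosure R)).comp (FreeGroup.lift g) =
        e.symm.toMonoidHom.comp (QuotientGroup.mk' N) := by
      ext i; simpa using hg i
    exact DFunLike.congr_fun this w
  set S : Set (FreeGroup α) := FreeGroup.lift f '' R ∪
    Set.range fun i : α => (FreeGroup.of i)⁻¹ * FreeGroup.lift f (FreeGroup.lift g (FreeGroup.of i))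
    with hS
  refine ⟨S, (hR.image _).union (Set.finite_range _), le_antisymm (normalClosure_le_normal ?_) ?_⟩
  · rintro _ (⟨r, hr, rfl⟩ | ⟨i, rfl⟩)
    · have h1 : QuotientGroup.mk' (normalClosure R) r = 1 :=
        (QuotientGroup.eq_one_iff r).2 (subset_normalClosure hr)
      have h2 := hF r
      rw [h1, map_one] at h2
      exact (QuotientGroup.eq_one_iff _).1 h2
    · refine (QuotientGroup.eq_one_iff _).1 (?_ : QuotientGroup.mk' N _ = 1)
      rw [map_mul, hF, hG]
      simp
  · intro w hw
    have h1 : FreeGroup.lift g w ∈ normalClosure R := by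
      refine (QuotientGroup.eq_one_iff _).1 (?_ : QuotientGroup.mk' _ _ = 1)
      have h0 : QuotientGroup.mk' N w = 1 := (QuotientGroup.eq_one_iff w).2 hw
      rw [hG, h0, map_one]
    have h2 : normalClosure R ≤ (normalClosure S).comap (FreeGroup.lift f) :=
      normalClosure_le_normal fun r hr =>
        subset_normalClosure (Or.inl (Set.mem_image_of_mem _ hr))
    have h3 : (QuotientGroup.mk' (normalClosure S)).comp
        ((FreeGroup.lift f).comp (FreeGroup.lift g)) = QuotientGroup.mk' (normalClosure S) := by
      ext i
      refine (QuotientGroup.eq.2 ?_).symm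
      exact subset_normalClosure (Or.inr ⟨i, rfl⟩)
    have h4 := DFunLike.congr_fun h3 w
    refine (QuotientGroup.eq_one_iff w).1 (h4.symm.trans ?_)
    exact (QuotientGroup.eq_one_iff _).2 (h2 h1)

theorem not_isFinitelyNormallyGenerated_iSup {G : Type*} [Group G] {M : ℕ → Subgroup G}
    (hM : Monotone M) [∀ j, (M j).Normal] (h : ∀ j, ∃ k, ¬ M k ≤ M j) :
    ¬ (⨆ j, M j).IsFinitelyNormallyGenerated := by
  rintro ⟨R, hR, hRM⟩
  have hmem : ∀ r ∈ R, ∃ j, r ∈ M j := fun r hr =>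
    (mem_iSup_of_directed hM.directed_le).1 (hRM ▸ subset_normalClosure hr)
  obtain ⟨j, hj⟩ : ∃ j, R ⊆ M j := by
    choose! d hd using hmem
    obtain ⟨j, hj⟩ := (hR.image d).bddAbove
    exact ⟨j, fun r hr => hM (hj (Set.mem_image_of_mem d hr)) (hd r hr)⟩
  obtain ⟨k, hk⟩ := h j
  exact hk ((le_iSup M k).trans (hRM ▸ normalClosure_le_normal hj))

/-- The normal closure of the `m`-th powers of the generators of a free group. -/
def powerSubgroup (α : Type*) (m : ℕ) : Subgroup (FreeGroup α) :=
  normalClosure (Set.range fun i => FreeGroup.of i ^ m)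

instance (α : Type*) (m : ℕ) : (powerSubgroup α m).Normal := normalClosure_normal

theorem isFinitelyNormallyGenerated_powerSubgroup (α : Type*) [Finite α] (m : ℕ) :
    (powerSubgroup α m).IsFinitelyNormallyGenerated :=
  ⟨_, Set.finite_range _, rfl⟩

theorem powerSubgroup_le_comap {α G : Type*} [Group G] {m : ℕ} {N : Subgroup G} [N.Normal]
    {φ : FreeGroup α →* G} (h : ∀ i, φ (FreeGroup.of i) ^ m ∈ N) :
    powerSubgroup α m ≤ N.comap φ := by
  refine normalClosure_le_normal ?_
  rintro _ ⟨i, rfl⟩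
  simpa using h i

theorem of_pow_mem_powerSubgroup {α : Type*} {m k : ℕ} (h : m ∣ k) (i : α) :
    FreeGroup.of i ^ k ∈ powerSubgroup α m := by
  obtain ⟨d, rfl⟩ := h
  rw [pow_mul]
  exact pow_mem (subset_normalClosure (Set.mem_range_self i)) d

theorem powerSubgroup_ne_top {α : Type*} [Nonempty α] {m : ℕ} (hm : m ≠ 1) :
    powerSubgroup α m ≠ ⊤ := by
  intro h
  obtain ⟨i⟩ := ‹Nonempty α›
  have h1 : powerSubgroup α m ≤ (⊥ : Subgroup (Multiplicative (ZMod m))).comap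
      (FreeGroup.lift fun _ => Multiplicative.ofAdd (1 : ZMod m)) :=
    powerSubgroup_le_comap fun i => by simp [← ofAdd_nsmul]
  have h2 := h1 (h ▸ mem_top (FreeGroup.of i))
  have h3 : (1 : ZMod m) = 0 := by simpa using h2
  have h4 : ((1 : ℕ) : ZMod m) = 0 := by simpa using h3
  rw [ZMod.natCast_eq_zero_iff] at h4
  exact hm (Nat.dvd_one.1 h4)

/-- The endomorphism of a free group that raises every generator to the `k`-th power. -/
def powerEnd (α : Type*) (k : ℕ) : FreeGroup α →* FreeGroup α :=
  FreeGroup.lift fun i => FreeGroup.of i ^ k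

@[simp]
theorem powerEnd_of {α : Type*} (k : ℕ) (i : α) :
    powerEnd α k (FreeGroup.of i) = FreeGroup.of i ^ k := by
  simp [powerEnd]

theorem powerEnd_mem_powerSubgroup {α : Type*} {m k : ℕ} (h : m ∣ k) (g : FreeGroup α) :
    powerEnd α k g ∈ powerSubgroup α m := by
  have h1 : (QuotientGroup.mk' (powerSubgroup α m)).comp (powerEnd α k) = 1 := by
    ext i
    exact (QuotientGroup.eq_one_iff _).2 (by simpa using of_pow_mem_powerSubgroup h i)
  exact (QuotientGroup.eq_one_iff _).1 (DFunLike.congr_fun h1 g)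

theorem of_inv_mul_of_pow_mem_powerSubgroup {α : Type*} {m k : ℕ} (h : k ≡ 1 [MOD m]) (i : α) :
    (FreeGroup.of i)⁻¹ * FreeGroup.of i ^ k ∈ powerSubgroup α m := by
  obtain ⟨d, hd⟩ : (m : ℤ) ∣ (k : ℤ) - 1 := Nat.modEq_iff_dvd.1 h.symm
  have h2 : (FreeGroup.of i)⁻¹ * FreeGroup.of i ^ k = (FreeGroup.of i ^ m) ^ d := by
    rw [← zpow_natCast, ← zpow_natCast, ← zpow_mul, ← hd, ← zpow_neg_one, ← zpow_add]
    congr 1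
  rw [h2]
  exact zpow_mem (subset_normalClosure (Set.mem_range_self i)) d

theorem inv_mul_powerEnd_mem_powerSubgroup {α : Type*} {m k : ℕ} (h : k ≡ 1 [MOD m])
    (g : FreeGroup α) : g⁻¹ * powerEnd α k g ∈ powerSubgroup α m := by
  have h1 : QuotientGroup.mk' (powerSubgroup α m) =
      (QuotientGroup.mk' (powerSubgroup α m)).comp (powerEnd α k) := by
    ext i
    exact QuotientGroup.eq.2 (by simpa using of_inv_mul_of_pow_mem_powerSubgroup h i)
  exact QuotientGroup.eq.1 (DFunLike.congr_fun h1 g)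

theorem exists_modEq_one_and_dvd {ι : Type*} [Finite ι] {q : ι → ℕ}
    (hq : Pairwise fun v w => (q v).Coprime (q w)) :
    ∃ e : ι → ℕ, (∀ v, e v ≡ 1 [MOD q v]) ∧ ∀ v w, v ≠ w → q w ∣ e v := by
  classical
  have := Fintype.ofFinite ι
  have h : ∀ v, ∃ k : ℕ, k ≡ 1 [MOD q v] ∧ ∀ w, v ≠ w → q w ∣ k := by
    intro v
    obtain ⟨k, hk1, hk0⟩ := Nat.chineseRemainder (n := q v)
      (m := ∏ w ∈ Finset.univ.erase v, q w)
      (Nat.Coprime.prod_right fun w hw => hq (Finset.ne_of_mem_erase hw).symm) 1 0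
    refine ⟨k, hk1, fun w hw => ?_⟩
    exact (Finset.dvd_prod_of_mem q (Finset.mem_erase.2 ⟨hw.symm, Finset.mem_univ w⟩)).trans
      (Nat.modEq_zero_iff_dvd.1 hk0)
  choose e he using h
  exact ⟨e, fun v => (he v).1, fun v => (he v).2⟩

theorem isFinitelyNormallyGenerated_iInf_powerSubgroup {α ι : Type*} [Finite α] [Finite ι]
    {q : ι → ℕ} (hq : Pairwise fun v w => (q v).Coprime (q w)) :
    (⨅ w, powerSubgroup α (q w)).IsFinitelyNormallyGenerated := by
  classical
  have := Fintype.ofFinite ι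
  obtain ⟨e, he1, he0⟩ := exists_modEq_one_and_dvd hq
  set R : Set (FreeGroup α) :=
    (Set.range fun x : ι × α => FreeGroup.of x.2 ^ (e x.1 * q x.1)) ∪
    (Set.range fun i : α => (FreeGroup.of i)⁻¹ * FreeGroup.of i ^ ∑ w, e w) ∪
    (Set.range fun x : {x : ι × ι // x.1 ≠ x.2} × α × α =>
      ⁅FreeGroup.of x.2.1 ^ e x.1.1.1, FreeGroup.of x.2.2 ^ e x.1.1.2⁆) with hR
  refine ⟨R, ((Set.finite_range _).union (Set.finite_range _)).union (Set.finite_range _),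
    le_antisymm (le_iInf fun v => normalClosure_le_normal ?_) ?_⟩
  · rintro _ ((⟨⟨w, i⟩, rfl⟩ | ⟨i, rfl⟩) | ⟨⟨⟨⟨w, w'⟩, hw⟩, i, j⟩, rfl⟩)
    · refine of_pow_mem_powerSubgroup ?_ i
      by_cases h : w = v
      · subst h
        exact dvd_mul_left _ _
      · exact (he0 w v h).mul_right _
    · refine of_inv_mul_of_pow_mem_powerSubgroup ?_ i
      rw [← Finset.add_sum_erase _ _ (Finset.mem_univ v)]
      have h0 : ∑ w ∈ Finset.univ.erase v, e w ≡ 0 [MOD q v] :=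
        Nat.modEq_zero_iff_dvd.2
          (Finset.dvd_sum fun w hw => he0 w v (Finset.ne_of_mem_erase hw))
      simpa using (he1 v).add h0
    · by_cases h : w = v
      · exact commutator_le_right ⊤ (powerSubgroup α (q v)) (commutator_mem_commutator (mem_top _)
          (of_pow_mem_powerSubgroup (he0 w' v (fun h' => hw (h.trans h'.symm))) j))
      · exact commutator_le_left (powerSubgroup α (q v)) ⊤ (commutator_mem_commutator
          (of_pow_mem_powerSubgroup (he0 w v h) i) (mem_top _))
  · set π := QuotientGroup.mk' (normalClosure R) with hπ
    have hπR : ∀ r ∈ R, π r = 1 := fun r hr =>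
      (QuotientGroup.eq_one_iff r).2 (subset_normalClosure hr)
    have hcomm : Pairwise fun v w : ι => ∀ g h : FreeGroup α,
        Commute ((π.comp (powerEnd α (e v))) g) ((π.comp (powerEnd α (e w))) h) := by
      intro v w hvw g h
      have hgen : ∀ i j, Commute (π (FreeGroup.of i ^ e v)) (π (FreeGroup.of j ^ e w)) := by
        intro i j
        rw [← commutatorElement_eq_one_iff_commute, ← map_commutatorElement]
        exact hπR _ (Or.inr ⟨⟨⟨⟨v, w⟩, hvw⟩, i, j⟩, rfl⟩)
      have h1 : ∀ i h, Commute (π (FreeGroup.of i ^ e v)) ((π.comp (powerEnd α (e w))) h) := by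
        intro i h
        induction h using FreeGroup.induction_on with
        | C1 => simp
        | of j => simpa using hgen i j
        | inv_of j ih => rw [map_inv]; exact ih.inv_right
        | mul x y hx hy => rw [map_mul]; exact hx.mul_right hy
      induction g using FreeGroup.induction_on with
      | C1 => simp
      | of j => simpa using h1 j h
      | inv_of j ih => rw [map_inv]; exact ih.inv_left
      | mul x y hx hy => rw [map_mul]; exact hx.mul_left hy
    have hΦ : (MonoidHom.noncommPiCoprod (fun w => π.comp (powerEnd α (e w))) hcomm).comp
        (MonoidHom.pi fun _ => MonoidHom.id _) = π := by
      ext i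
      have h1 : π ((FreeGroup.of i)⁻¹ * FreeGroup.of i ^ ∑ w, e w) = 1 :=
        hπR _ (Or.inl (Or.inr ⟨i, rfl⟩))
      have h2 : π (FreeGroup.of i) = π (FreeGroup.of i) ^ ∑ w, e w := by
        rw [map_mul, map_inv, inv_mul_eq_one, map_pow] at h1
        exact h1
      rw [h2, MonoidHom.comp_apply, MonoidHom.noncommPiCoprod_apply]
      have h3 := Finset.map_noncommProd Finset.univ
        (fun w => Multiplicative.ofAdd (e w)) (fun _ _ _ _ _ => mul_comm _ _)
        (powersHom _ (π (FreeGroup.of i)))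
      rw [Finset.noncommProd_eq_prod, ← ofAdd_sum] at h3
      simpa [-ofAdd_sum, MonoidHom.pi] using h3.symm
    intro g hg
    refine (QuotientGroup.eq_one_iff g).1 ((DFunLike.congr_fun hΦ g).symm.trans ?_)
    rw [MonoidHom.comp_apply, MonoidHom.noncommPiCoprod_apply]
    refine Finset.noncommProd_eq_pow_card _ _ _ 1 (fun w _ => ?_) |>.trans (one_pow _)
    have h1 : powerSubgroup α (q w) ≤ (⊥ : Subgroup _).comap (π.comp (powerEnd α (e w))) := by
      refine powerSubgroup_le_comap fun i => mem_bot.2 ?_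
      rw [MonoidHom.comp_apply, powerEnd_of, ← map_pow, ← pow_mul]
      exact hπR _ (Or.inl (Or.inl ⟨⟨w, i⟩, rfl⟩))
    exact mem_bot.1 (h1 (mem_iInf.1 hg w))

namespace RegularWreathProduct

/-- The inclusion of the base group into a regular wreath product. -/
def base (D Q : Type*) [Group D] [Group Q] : (Q → D) →* D ≀ᵣ Q where
  toFun f := ⟨f, 1⟩
  map_one' := rfl
  map_mul' f g := by ext <;> simp

@[simp]
theorem base_left {D Q : Type*} [Group D] [Group Q] (f : Q → D) : (base D Q f).left = f := rfl

@[simp]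
theorem base_right {D Q : Type*} [Group D] [Group Q] (f : Q → D) : (base D Q f).right = 1 := rfl

theorem base_injective {D Q : Type*} [Group D] [Group Q] : Function.Injective (base D Q) :=
  fun _ _ h => congrArg RegularWreathProduct.left h

theorem inl_mul_base_mul_inv {D Q : Type*} [Group D] [Group Q] (s : Q) (f : Q → D) :
    inl s * base D Q f * (inl s)⁻¹ = base D Q fun q => f (s⁻¹ * q) := by
  ext <;> simp

/-- The elements of the base group with all coordinates in `Z`. -/
def basePower {D : Type*} (Q : Type*) [Group D] [Group Q] (Z : Subgroup D) :
    Subgroup (D ≀ᵣ Q) :=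
  (Subgroup.pi Set.univ fun _ => Z).map (base D Q)

theorem basePower_mono {D Q : Type*} [Group D] [Group Q] {Z Z' : Subgroup D} (h : Z ≤ Z') :
    basePower Q Z ≤ basePower Q Z' :=
  map_mono fun _ hf q hq => h (hf q hq)

theorem normal_basePower {D Q : Type*} [Group D] [Group Q] {Z : Subgroup D}
    (hZ : Z ≤ center D) : (basePower Q Z).Normal := by
  refine ⟨?_⟩
  rintro _ ⟨f, hf, rfl⟩ g
  refine ⟨fun q => f (g.right⁻¹ * q), fun q _ => hf _ (Set.mem_univ _), ?_⟩
  ext q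
  · have h := mem_center_iff.1 (hZ (hf (g.right⁻¹ * q) (Set.mem_univ _))) (g.left q)
    simp [h]
  · simp

theorem base_mulSingle_mem_basePower_iff {D Q : Type*} [Group D] [Group Q] [DecidableEq Q]
    {Z : Subgroup D} {q : Q} {c : D} :
    base D Q (Pi.mulSingle q c) ∈ basePower Q Z ↔ c ∈ Z := by
  rw [basePower, mem_map_iff_mem base_injective, mulSingle_mem_pi]
  simp

end RegularWreathProduct

open RegularWreathProduct

theorem exists_wreathProduct_generators {C : Type*} [Group C] {p : ℕ} [Fact p.Prime] (hp : 7 ≤ p)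
    {x y z t : C} (hx : x ^ p = 1) (hy : y ^ p = 1) (hz : z ^ p = 1) (ht : t ^ p = 1) :
    ∃ a b : C ≀ᵣ Multiplicative (ZMod p), a ^ p = 1 ∧ b ^ p = 1 ∧
      ∃ D : Subgroup C, ⁅x, y⁆ ∈ D ∧ (∀ c ∈ D, ⁅c, x⁆ ∈ D ∧ ⁅c, y⁆ ∈ D ∧ ⁅c, z⁆ ∈ D ∧ ⁅c, t⁆ ∈ D) ∧
        ∀ c ∈ D, base C (Multiplicative (ZMod p)) (Pi.mulSingle 1 c) ∈ closure {a, b} := by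
  have hne : ∀ k : ℕ, 0 < k → k < p → (k : ZMod p) ≠ 0 := fun k hk hkp h =>
    absurd (Nat.le_of_dvd hk ((ZMod.natCast_eq_zero_iff k p).1 h)) (by omega)
  have n1 := hne 1 (by omega) (by omega)
  have n2 := hne 2 (by omega) (by omega)
  have n3 := hne 3 (by omega) (by omega)
  have n4 := hne 4 (by omega) (by omega)
  have n5 := hne 5 (by omega) (by omega)
  have n6 := hne 6 (by omega) (by omega)
  push_cast at n1 n2 n3 n4 n5 n6
  set f : ZMod p → C := fun r =>
    if r = 0 then y else if r = 1 then x else if r = 3 then z else if r = 5 then t else 1 with hf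
  have f0 : f 0 = y := by simp [hf]
  have f1 : f 1 = x := by simp [hf]
  have f3 : f 3 = z := by
    have : (3 : ZMod p) ≠ 1 := fun h => n2 (by linear_combination h)
    simp [hf, n3, this]
  have f5 : f 5 = t := by
    have h1 : (5 : ZMod p) ≠ 1 := fun h => n4 (by linear_combination h)
    have h2 : (5 : ZMod p) ≠ 3 := fun h => n2 (by linear_combination h)
    simp [hf, n5, h1, h2]
  have fsupp : ∀ r, f r = 1 ∨ r = 0 ∨ r = 1 ∨ r = 3 ∨ r = 5 := by
    intro r
    simp only [hf]
    split_ifs <;> simp_all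
  have fcomm : ∀ r, r ≠ 1 → ⁅f r, f (r - 1)⁆ = 1 := by
    intro r hr
    rcases fsupp r with h | h
    · rw [h, commutatorElement_one_left]
    rcases fsupp (r - 1) with h' | h'
    · rw [h', commutatorElement_one_right]
    exfalso
    rcases h with rfl | h | rfl | rfl
    · rcases h' with h' | h' | h' | h'
      · exact n1 (by linear_combination -h')
      · exact n2 (by linear_combination -h')
      · exact n4 (by linear_combination -h')
      · exact n6 (by linear_combination -h')
    · exact hr h
    · rcases h' with h' | h' | h' | h'
      · exact n2 (by linear_combination h')
      · exact n1 (by linear_combination h')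
      · exact n1 (by linear_combination -h')
      · exact n3 (by linear_combination -h')
    · rcases h' with h' | h' | h' | h'
      · exact n4 (by linear_combination h')
      · exact n3 (by linear_combination h')
      · exact n1 (by linear_combination h')
      · exact n1 (by linear_combination -h')
  have fp : ∀ r, f r ^ p = 1 := by
    intro r
    simp only [hf]
    split_ifs <;> simp_all
  set B := base C (Multiplicative (ZMod p)) with hB
  set F : Multiplicative (ZMod p) → C := fun q => f q.toAdd with hF
  set s : Multiplicative (ZMod p) := Multiplicative.ofAdd 1 with hs
  set a : C ≀ᵣ Multiplicative (ZMod p) := inl s with ha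
  set b : C ≀ᵣ Multiplicative (ZMod p) := B F with hb
  have hacl : a ∈ closure {a, b} := subset_closure (by simp)
  have hbcl : b ∈ closure {a, b} := subset_closure (by simp)
  have hshift : ∀ q c, B (Pi.mulSingle q c) ∈ closure {a, b} →
      B (Pi.mulSingle (s * q) c) ∈ closure {a, b} := by
    intro q c h
    have h1 := mul_mem (mul_mem hacl h) (inv_mem hacl)
    rw [ha, hB, inl_mul_base_mul_inv] at h1
    convert h1 using 2
    ext r
    simp only [Pi.mulSingle_apply, inv_mul_eq_iff_eq_mul]
  have hshift_pow : ∀ (k : ℕ) q c, B (Pi.mulSingle q c) ∈ closure {a, b} →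
      B (Pi.mulSingle (s ^ k * q) c) ∈ closure {a, b} := by
    intro k
    induction k with
    | zero => simp
    | succ k ih =>
      intro q c h
      rw [pow_succ', mul_assoc]
      exact hshift _ _ (ih q c h)
  have hall : ∀ q q' c, B (Pi.mulSingle q c) ∈ closure {a, b} →
      B (Pi.mulSingle q' c) ∈ closure {a, b} := by
    intro q q' c h
    have h1 := hshift_pow (q' / q).toAdd.val q c h
    have h2 : s ^ (q' / q).toAdd.val = q' / q := by
      rw [hs, ← ofAdd_nsmul, nsmul_one, ZMod.natCast_zmod_val, ofAdd_toAdd]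
    rwa [h2, div_mul_cancel] at h1
  have hcomm : ∀ q c, B (Pi.mulSingle 1 c) ∈ closure {a, b} →
      B (Pi.mulSingle 1 ⁅c, F q⁆) ∈ closure {a, b} := by
    intro q c h
    refine hall q 1 _ ?_
    have h1 : (Pi.mulSingle q ⁅c, F q⁆ : Multiplicative (ZMod p) → C) =
        ⁅(Pi.mulSingle q c : Multiplicative (ZMod p) → C), F⁆ := by
      ext r
      by_cases hr : r = q
      · subst hr
        simp [commutatorElement_def]
      · simp [commutatorElement_def, Pi.mulSingle_eq_of_ne hr]
    rw [h1, map_commutatorElement]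
    have h2 := hall 1 q c h
    exact mul_mem (mul_mem (mul_mem h2 hbcl) (inv_mem h2)) (inv_mem hbcl)
  refine ⟨a, b, ?_, ?_, (closure {a, b}).comap (B.comp (MonoidHom.mulSingle (fun _ => C) 1)),
    ?_, ?_, fun c hc => hc⟩
  · rw [ha, ← map_pow, hs, ← ofAdd_nsmul]
    simp
  · rw [hb, ← map_pow]
    have : F ^ p = 1 := funext fun q => fp _
    rw [this, map_one]
  · refine hall s 1 _ ?_
    have h1 : Pi.mulSingle s ⁅x, y⁆ = ⁅F, fun q => F (s⁻¹ * q)⁆ := by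
      ext r
      by_cases hr : r = s
      · subst hr
        simp [commutatorElement_def, hF, hs, f0, f1]
      · rw [Pi.mulSingle_eq_of_ne hr]
        have h2 : r.toAdd ≠ 1 := fun h => hr (by rw [hs, ← h, ofAdd_toAdd])
        have h3 := fcomm _ h2
        rw [sub_eq_neg_add] at h3
        exact h3.symm
    rw [h1, map_commutatorElement, hB, ← inl_mul_base_mul_inv]
    have h2 := mul_mem (mul_mem hacl hbcl) (inv_mem hacl)
    exact mul_mem (mul_mem (mul_mem hbcl h2) (inv_mem hbcl)) (inv_mem h2)
  · intro c hc
    refine ⟨?_, ?_, ?_, ?_⟩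
    · exact f1 ▸ hcomm (Multiplicative.ofAdd 1) c hc
    · exact f0 ▸ hcomm (Multiplicative.ofAdd 0) c hc
    · exact f3 ▸ hcomm (Multiplicative.ofAdd 3) c hc
    · exact f5 ▸ hcomm (Multiplicative.ofAdd 5) c hc

/-- Transvections as a homomorphism from the additive group of the ring to the unit group of
the matrix ring. -/
def Matrix.transvectionHom {n A : Type*} [Fintype n] [DecidableEq n] [CommRing A] {i j : n}
    (h : i ≠ j) : Multiplicative A →* (Matrix n n A)ˣ :=
  MonoidHom.toHomUnits
    { toFun := fun c => Matrix.transvection i j c.toAdd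
      map_one' := Matrix.transvection_zero i j
      map_mul' := fun _ _ => (Matrix.transvection_mul_transvection_same i j h _ _).symm }

namespace Matrix

variable {n A : Type*} [Fintype n] [DecidableEq n] [CommRing A]

theorem val_transvectionHom {i j : n} (h : i ≠ j) (c : Multiplicative A) :
    (transvectionHom h c : Matrix n n A) = 1 + Matrix.single i j c.toAdd := rfl

theorem val_inv_transvectionHom {i j : n} (h : i ≠ j) (c : Multiplicative A) :
    ((transvectionHom h c)⁻¹ : (Matrix n n A)ˣ).val = 1 - Matrix.single i j c.toAdd := by
  rw [← map_inv, val_transvectionHom, toAdd_inv, ← Matrix.single_neg, sub_eq_add_neg]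

theorem transvectionHom_injective {i j : n} (h : i ≠ j) :
    Function.Injective (transvectionHom h : Multiplicative A →* (Matrix n n A)ˣ) := by
  intro c d hcd
  have h1 := congrArg (fun M : (Matrix n n A)ˣ => (M : Matrix n n A) i j) hcd
  simpa [val_transvectionHom] using h1

theorem commutatorElement_transvectionHom {i j k : n} (hij : i ≠ j) (hjk : j ≠ k) (hik : i ≠ k)
    (c d : A) :
    ⁅transvectionHom hij (Multiplicative.ofAdd c), transvectionHom hjk (Multiplicative.ofAdd d)⁆ =
      transvectionHom hik (Multiplicative.ofAdd (c * d)) := by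
  refine Units.ext ?_
  rw [commutatorElement_def]
  simp only [Units.val_mul, val_transvectionHom, val_inv_transvectionHom, toAdd_ofAdd]
  have h1 : Matrix.single i j c * Matrix.single i j c = 0 :=
    single_mul_single_of_ne _ _ _ _ hij.symm _
  have h2 : Matrix.single j k d * Matrix.single j k d = 0 :=
    single_mul_single_of_ne _ _ _ _ hjk.symm _
  have h3 : Matrix.single j k d * Matrix.single i j c = 0 :=
    single_mul_single_of_ne _ _ _ _ hik.symm _
  rw [← single_mul_single_same (i := i) (j := j) (k := k) (c := c) (d := d)]
  generalize Matrix.single i j c = M at *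
  generalize Matrix.single j k d = N at *
  have e : (1 + M) * (1 + N) * (1 - M) * (1 - N) = 1 + M * N - M * M * (1 - N) - N * N
      - N * M * (1 - N) - M * (N * M) * (1 - N) - M * (N * N) := by noncomm_ring
  rw [e, h1, h2, h3]
  simp

theorem transvectionHom_pow {i j : n} (h : i ≠ j) (p : ℕ) [CharP A p] (c : Multiplicative A) :
    transvectionHom h c ^ p = 1 := by
  rw [← map_pow]
  have : c ^ p = 1 := by
    rw [← ofAdd_toAdd c, ← ofAdd_nsmul, nsmul_eq_mul, CharP.cast_eq_zero, zero_mul, ofAdd_zero]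
  rw [this, map_one]

theorem transvectionHom_mem_centralizer {i j k l : n} (hij : i ≠ j) (hkl : k ≠ l)
    (h1 : j ≠ k) (h2 : l ≠ i) (c : Multiplicative A) :
    transvectionHom hij c ∈
      centralizer (MonoidHom.range (transvectionHom (A := A) hkl) : Set (Matrix n n A)ˣ) := by
  rw [mem_centralizer_iff]
  rintro _ ⟨d, rfl⟩
  refine Units.ext ?_
  simp [val_transvectionHom, mul_add, add_mul, single_mul_single_of_ne _ _ _ _ h1,
    single_mul_single_of_ne _ _ _ _ h2]
  abel

end Matrix

open Matrix in
theorem exists_central_chain (p : ℕ) [Fact p.Prime] :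
    ∃ (C : Type) (_ : Group C) (x y z t : C) (Z : ℕ → Subgroup C),
      x ^ p = 1 ∧ y ^ p = 1 ∧ z ^ p = 1 ∧ t ^ p = 1 ∧ Monotone Z ∧ (∀ m, Z m ≤ center C) ∧
      ∀ D : Subgroup C, ⁅x, y⁆ ∈ D →
        (∀ c ∈ D, ⁅c, x⁆ ∈ D ∧ ⁅c, y⁆ ∈ D ∧ ⁅c, z⁆ ∈ D ∧ ⁅c, t⁆ ∈ D) →
        ∀ m, ∃ k, ∃ c ∈ D, c ∈ Z k ∧ c ∉ Z m := by
  let A := Polynomial (ZMod p)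
  let T : ∀ {i j : Fin 4}, i ≠ j → A → (Matrix (Fin 4) (Fin 4) A)ˣ :=
    fun h c => transvectionHom h (Multiplicative.ofAdd c)
  have h03 : (0 : Fin 4) ≠ 3 := by decide
  have h01 : (0 : Fin 4) ≠ 1 := by decide
  have h12 : (1 : Fin 4) ≠ 2 := by decide
  have h21 : (2 : Fin 4) ≠ 1 := by decide
  have h23 : (2 : Fin 4) ≠ 3 := by decide
  have h02 : (0 : Fin 4) ≠ 2 := by decide
  let C := centralizer (MonoidHom.range (transvectionHom (A := A) h03) :
    Set (Matrix (Fin 4) (Fin 4) A)ˣ)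
  let L : ℕ → Subgroup (Multiplicative A) := fun m =>
    AddSubgroup.toSubgroup (Polynomial.degreeLT (ZMod p) m).toAddSubgroup
  have hL : ∀ m c, c ∈ L m ↔ c.toAdd.degree < m := fun m c => Polynomial.mem_degreeLT
  have mem (i j : Fin 4) (h : i ≠ j) (hj : j ≠ 0) (hi : 3 ≠ i) (c : A) : T h c ∈ C :=
    transvectionHom_mem_centralizer h h03 hj hi _
  have m01 := mem 0 1 h01 (by decide) (by decide)
  have m12 := mem 1 2 h12 (by decide) (by decide)
  have m21 := mem 2 1 h21 (by decide) (by decide)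
  have m23 := mem 2 3 h23 (by decide) (by decide)
  have m02 := mem 0 2 h02 (by decide) (by decide)
  have m03 := mem 0 3 h03 (by decide) (by decide)
  have hpow (i j : Fin 4) (h : i ≠ j) (c : A) : T h c ^ p = 1 := transvectionHom_pow h p _
  refine ⟨C, inferInstance, ⟨T h01 1, m01 1⟩, ⟨T h12 1, m12 1⟩, ⟨T h21 Polynomial.X, m21 _⟩,
    ⟨T h23 1, m23 1⟩, fun m => ((L m).map (transvectionHom h03)).subgroupOf C,
    Subtype.ext (hpow _ _ _ _), Subtype.ext (hpow _ _ _ _), Subtype.ext (hpow _ _ _ _),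
    Subtype.ext (hpow _ _ _ _), ?_, ?_, ?_⟩
  · intro m k hmk
    refine comap_mono (map_mono ?_)
    intro c hc
    exact Polynomial.degreeLT_mono hmk hc
  · rintro m ⟨g, hg⟩ hgm
    obtain ⟨c, -, rfl⟩ := mem_subgroupOf.1 hgm
    refine mem_center_iff.2 fun h => Subtype.ext ?_
    exact (mem_centralizer_iff.1 h.2 _ ⟨c, rfl⟩).symm
  · intro D hD hDc m
    have h02D : ∀ k : ℕ, (⟨T h02 (Polynomial.X ^ k), m02 _⟩ : C) ∈ D := by
      intro k
      induction k with
      | zero =>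
        convert hD
        exact (congrArg (T h02) (by simp)).trans
          (commutatorElement_transvectionHom h01 h12 h02 (1 : A) 1).symm
      | succ k ih =>
        have h1 : (⟨T h01 (Polynomial.X ^ (k + 1)), m01 _⟩ : C) ∈ D := by
          convert (hDc _ ih).2.2.1
          exact (congrArg (T h01) (pow_succ _ _)).trans
            (commutatorElement_transvectionHom h02 h21 h01 (Polynomial.X ^ k : A)
              Polynomial.X).symm
        convert (hDc _ h1).2.1
        exact (congrArg (T h02) (mul_one _).symm).trans
          (commutatorElement_transvectionHom h01 h12 h02 (Polynomial.X ^ (k + 1) : A) 1).symm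
    have h03D : (⟨T h03 (Polynomial.X ^ m), m03 _⟩ : C) ∈ D := by
      convert (hDc _ (h02D m)).2.2.2
      exact (congrArg (T h03) (mul_one _).symm).trans
        (commutatorElement_transvectionHom h02 h23 h03 (Polynomial.X ^ m : A) 1).symm
    refine ⟨m + 1, _, h03D, ?_, ?_⟩
    · refine mem_subgroupOf.2 ⟨Multiplicative.ofAdd (Polynomial.X ^ m), ?_, rfl⟩
      rw [SetLike.mem_coe, hL, toAdd_ofAdd, Polynomial.degree_X_pow]
      exact_mod_cast Nat.lt_succ_self m
    · intro h
      obtain ⟨c, hc, hcm⟩ := mem_subgroupOf.1 h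
      have h1 := transvectionHom_injective h03 hcm
      subst h1
      have h2 := (hL _ _).1 hc
      rw [toAdd_ofAdd, Polynomial.degree_X_pow] at h2
      exact lt_irrefl _ h2

theorem exists_normal_not_isFinitelyNormallyGenerated {α : Type*} [Nontrivial α] {p : ℕ}
    [Fact p.Prime] (hp : 7 ≤ p) :
    ∃ K : Subgroup (FreeGroup α), K.Normal ∧ powerSubgroup α p ≤ K ∧
      ¬ K.IsFinitelyNormallyGenerated := by
  classical
  obtain ⟨C, _, x, y, z, t, Z, hx, hy, hz, ht, hZ, hZC, hD⟩ := exists_central_chain p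
  obtain ⟨a, b, ha, hb, D, hxy, hDc, hDab⟩ := exists_wreathProduct_generators hp hx hy hz ht
  obtain ⟨i, j, hij⟩ := exists_pair_ne α
  set φ : FreeGroup α →* C ≀ᵣ Multiplicative (ZMod p) :=
    FreeGroup.lift fun k => if k = i then a else if k = j then b else 1 with hφ
  have hφi : φ (FreeGroup.of i) = a := by simp [hφ]
  have hφj : φ (FreeGroup.of j) = b := by simp [hφ, hij.symm]
  have hφp : ∀ k, φ (FreeGroup.of k) ^ p = 1 := by
    intro k
    simp only [hφ, FreeGroup.lift_apply_of]
    split_ifs <;> simp [ha, hb]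
  have hrange : closure {a, b} ≤ φ.range := by
    rw [closure_le]
    rintro _ (rfl | rfl)
    · exact ⟨_, hφi⟩
    · exact ⟨_, hφj⟩
  have hn : ∀ m, (basePower (Multiplicative (ZMod p)) (Z m)).Normal :=
    fun m => normal_basePower (hZC m)
  let M : ℕ → Subgroup (FreeGroup α) := fun m =>
    (basePower (Multiplicative (ZMod p)) (Z m)).comap φ
  have hMn : ∀ m, (M m).Normal := fun m => (hn m).comap φ
  have hM : Monotone M := fun m k h => comap_mono (basePower_mono (hZ h))
  refine ⟨⨆ m, M m, inferInstance, le_iSup_of_le 0 (powerSubgroup_le_comap fun k => ?_),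
    not_isFinitelyNormallyGenerated_iSup hM fun m => ?_⟩
  · rw [hφp]
    exact one_mem _
  · obtain ⟨k, c, hcD, hck, hcm⟩ := hD D hxy hDc m
    obtain ⟨w, hw⟩ := hrange (hDab c hcD)
    refine ⟨k, fun h => hcm ?_⟩
    have h1 : w ∈ M m := h (by
      rw [mem_comap, hw]
      exact base_mulSingle_mem_basePower_iff.2 hck)
    rw [mem_comap, hw] at h1
    exact base_mulSingle_mem_basePower_iff.1 h1

theorem exists_primes_ge (V : Type*) [Finite V] (m : ℕ) :
    ∃ q : V → ℕ, Function.Injective q ∧ ∀ v, (q v).Prime ∧ m ≤ q v := by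
  have hinf : {p : ℕ | p.Prime ∧ m ≤ p}.Infinite := by
    refine Set.infinite_of_not_bddAbove ?_
    rintro ⟨B, hB⟩
    obtain ⟨p, hp, hpp⟩ := Nat.exists_infinite_primes (max m (B + 1))
    have := hB ⟨hpp, (le_max_left _ _).trans hp⟩
    have := (le_max_right _ _).trans hp
    omega
  have := hinf.to_subtype
  obtain ⟨k, ⟨e⟩⟩ := Finite.exists_equiv_fin V
  let f := Infinite.natEmbedding {p : ℕ | p.Prime ∧ m ≤ p}
  exact ⟨fun v => f (e v), fun v w h => e.injective (Fin.ext (f.injective (Subtype.ext h))),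
    fun v => (f (e v)).2⟩

theorem finitelyPresented_quotient_iff {n : ℕ} (N : Subgroup (FreeGroup (Fin n))) [N.Normal] :
    FinitelyPresented (FreeGroup (Fin n) ⧸ N) ↔ N.IsFinitelyNormallyGenerated := by
  constructor
  · rintro ⟨m, R, hR, ⟨e⟩⟩
    exact isFinitelyNormallyGenerated_of_quotient_mulEquiv hR e
  · rintro ⟨R, hR, rfl⟩
    exact ⟨n, R, hR, ⟨MulEquiv.refl _⟩⟩

/-- The normal subgroup attached to `v`: the subgroup `K v` cut down by the power subgroups of all
the elements that are not below `v`. -/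
def posetSubgroup {α V : Type*} [LE V] (q : V → ℕ) (K : V → Subgroup (FreeGroup α)) (v : V) :
    Subgroup (FreeGroup α) :=
  K v ⊓ ⨅ w : {w // ¬ w ≤ v}, powerSubgroup α (q w)

section PosetSubgroup

variable {α V : Type*} [Finite V] [PartialOrder V] {q : V → ℕ} {K : V → Subgroup (FreeGroup α)}

theorem exists_mem_posetSubgroup (hq : Pairwise fun v w => (q v).Coprime (q w))
    (hK : ∀ v, powerSubgroup α (q v) ≤ K v) {v : V} {g : FreeGroup α} (hg : g ∈ K v) :
    ∃ h ∈ posetSubgroup q K v, g⁻¹ * h ∈ powerSubgroup α (q v) := by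
  obtain ⟨e, he1, he0⟩ := exists_modEq_one_and_dvd hq
  have h1 := inv_mul_powerEnd_mem_powerSubgroup (he1 v) g
  refine ⟨powerEnd α (e v) g, mem_inf.2 ⟨?_, mem_iInf.2 fun w => ?_⟩, h1⟩
  · exact ((K v).mul_mem_cancel_left (inv_mem hg)).1 (hK v h1)
  · exact powerEnd_mem_powerSubgroup (he0 v w fun h => w.2 (h ▸ le_rfl)) g

theorem posetSubgroup_le_iff (hq : Pairwise fun v w => (q v).Coprime (q w))
    (hK : ∀ v, powerSubgroup α (q v) < K v) {u v : V} :
    posetSubgroup q K u ≤ posetSubgroup q K v ↔ u ≤ v := by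
  constructor
  · intro h
    by_contra huv
    obtain ⟨g, hgK, hg⟩ := SetLike.exists_of_lt (hK u)
    obtain ⟨k, hk, hgk⟩ := exists_mem_posetSubgroup hq (fun v => (hK v).le) hgK
    have h1 : k ∈ powerSubgroup α (q u) := mem_iInf.1 (mem_inf.1 (h hk)).2 ⟨u, huv⟩
    exact hg (inv_mem_iff.1 (((powerSubgroup α (q u)).mul_mem_cancel_right h1).1 hgk))
  · intro h
    refine le_inf ?_ (le_iInf fun w => inf_le_right.trans
      (iInf_le _ (⟨w, fun hw => w.2 (hw.trans h)⟩ : {w // ¬ w ≤ u})))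
    rcases h.eq_or_lt with rfl | h
    · exact inf_le_left
    · exact (inf_le_right.trans (iInf_le _ (⟨v, h.not_ge⟩ : {w // ¬ w ≤ u}))).trans (hK v).le

instance [∀ v, (K v).Normal] (v : V) : (posetSubgroup q K v).Normal := by
  have : (⨅ w : {w // ¬ w ≤ v}, powerSubgroup α (q w)).Normal :=
    normal_iInf_normal fun _ => inferInstance
  exact normal_inf_normal _ _

theorem isFinitelyNormallyGenerated_posetSubgroup_iff [Finite α]
    (hq : Pairwise fun v w => (q v).Coprime (q w)) [∀ v, (K v).Normal]
    (hK : ∀ v, powerSubgroup α (q v) ≤ K v) {v : V}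
    (hv : K v = ⊤ ∨ ¬ (K v).IsFinitelyNormallyGenerated) :
    (posetSubgroup q K v).IsFinitelyNormallyGenerated ↔ K v = ⊤ := by
  constructor
  · rintro ⟨R, hR, hRN⟩
    refine hv.resolve_right (not_not_intro ?_)
    obtain ⟨S, hS, hSq⟩ := isFinitelyNormallyGenerated_powerSubgroup α (q v)
    refine ⟨R ∪ S, hR.union hS, ?_⟩
    rw [normalClosure_union, hRN, hSq]
    refine le_antisymm (sup_le inf_le_left (hK v)) fun g hg => ?_
    obtain ⟨h, hh, hgh⟩ := exists_mem_posetSubgroup hq hK hg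
    rw [show g = h * (g⁻¹ * h)⁻¹ by group]
    exact mul_mem_sup hh (inv_mem hgh)
  · intro h
    rw [posetSubgroup, h, top_inf_eq]
    exact isFinitelyNormallyGenerated_iInf_powerSubgroup
      fun a b hab => hq fun h => hab (Subtype.ext h)

end PosetSubgroup

/-- Every free group of finite rank `n ≥ 2` is quotient-saturated. -/
theorem stmt_11 (n : ℕ) (hn : 2 ≤ n) : QuotientSaturated (FreeGroup (Fin n)) := by
  intro V _ _ c
  have : Nontrivial (Fin n) := Fin.nontrivial_iff_two_le.2 hn
  obtain ⟨q, hqi, hqp⟩ := exists_primes_ge V 7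
  have hq : Pairwise fun v w => (q v).Coprime (q w) := fun v w hvw =>
    (Nat.coprime_primes (hqp v).1 (hqp w).1).2 fun h => hvw (hqi h)
  have hfg := fun v => isFinitelyNormallyGenerated_powerSubgroup (Fin n) (q v)
  have hex : ∀ v, ∃ K : Subgroup (FreeGroup (Fin n)), K.Normal ∧
      powerSubgroup (Fin n) (q v) < K ∧ (c v = 0 → K = ⊤) ∧
      (c v ≠ 0 → ¬ K.IsFinitelyNormallyGenerated) := by
    intro v
    by_cases hv : c v = 0
    · exact ⟨⊤, inferInstance, (powerSubgroup_ne_top (hqp v).1.ne_one).lt_top, fun _ => rfl,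
        fun h => absurd hv h⟩
    · have : Fact (q v).Prime := ⟨(hqp v).1⟩
      obtain ⟨K, hKn, hle, hK⟩ :=
        exists_normal_not_isFinitelyNormallyGenerated (α := Fin n) (hqp v).2
      exact ⟨K, hKn, hle.lt_of_ne fun h => hK (h ▸ hfg v), fun h => absurd h hv, fun _ => hK⟩
  choose K hKn hK hK0 hK1 using hex
  have hle := fun u v => posetSubgroup_le_iff hq hK (u := u) (v := v)
  refine ⟨posetSubgroup q K, fun u v h => le_antisymm ((hle u v).1 h.le) ((hle v u).1 h.ge),
    fun u v => (hle u v).symm, fun v => ⟨inferInstance, ?_⟩⟩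
  have htop : (⊤ : Subgroup (FreeGroup (Fin n))).IsFinitelyNormallyGenerated :=
    .of_FG _
  refine (finitelyPresented_quotient_iff _).trans
    ((isFinitelyNormallyGenerated_posetSubgroup_iff hq (fun v => (hK v).le) ?_).trans ?_)
  · by_cases hv : c v = 0
    · exact Or.inl (hK0 v hv)
    · exact Or.inr (hK1 v hv)
  · refine ⟨fun h => by_contra fun hv => hK1 v hv (h ▸ htop), hK0 v⟩
end
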